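/- arXiv:2605.24443 — 2 statements merged into one kernel-verified Lean document; each statement's English description precedes it below -/
import Mathlib

section
/- Alternative second-variation estimate for strictly ordered parameters. Under the same hypotheses as the two-parameter second-variation inequality (n ≤ d ≤ D < ∞, V, W smooth with V > −d, W > −D, φ smooth convex solving (Z_V/Z_W)^{1/d} det(D²φ)^{1/d} = exp((Θ_D(W∘∇φ) − Θ_d(V))/d), and (x, e) ↦ ⟨D²φ(x)e, e⟩ attaining its maximum at (x̄, e₁)), with ȳ = ∇φ(x̄), λ = ⟨D²φ(x̄)e₁, e₁⟩, V₁ = ⟨∇V(x̄), e₁⟩, V₁₁ = ⟨D²V(x̄)e₁, e₁⟩, W₁ = ⟨∇W(ȳ), e₁⟩, W₁₁ = ⟨D²W(ȳ)e₁, e₁⟩, V = V(x̄), W = W(ȳ): if d < D, then (D/(D+W))·W₁₁·λ² ≤ (d/(d+V))·V₁₁ + (d/(d+V)²)·max{0, (2d−D)/(D−d)}·V₁². -/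
open MeasureTheory Metric Set
open scoped ENNReal RealInnerProductSpace

noncomputable section

/-- Euclidean space `ℝⁿ`. -/
abbrev Euc (n : ℕ) := EuclideanSpace ℝ (Fin n)

/-- The second directional derivative `⟨D²f(x)v, v⟩`. -/
def hess {n : ℕ} (f : Euc n → ℝ) (x v : Euc n) : ℝ :=
  iteratedFDeriv ℝ 2 f x ![v, v]

/-- The normalization constant `Z_{U,p} = ∫ (1 + U(x)/p)^(−p) dx`. -/
def Znorm {n : ℕ} (U : Euc n → ℝ) (p : ℝ) : ℝ :=
  ∫ x, (1 + U x / p) ^ (-p)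

/-- The measure `μ_{U,p}` with density `Z_{U,p}⁻¹ (1 + U(x)/p)^(−p)` w.r.t. Lebesgue. -/
def muUP {n : ℕ} (U : Euc n → ℝ) (p : ℝ) : Measure (Euc n) :=
  volume.withDensity fun x => ENNReal.ofReal ((Znorm U p)⁻¹ * (1 + U x / p) ^ (-p))

/-- The ratio `(p + U(x))/(p + |x|²)`. -/
def ratio0 {n : ℕ} (U : Euc n → ℝ) (p : ℝ) (x : Euc n) : ℝ :=
  (p + U x) / (p + ‖x‖ ^ 2)

/-- The ratio `|∇U(x)|²/(√p + |x|)²`. -/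
def ratio1 {n : ℕ} (U : Euc n → ℝ) (p : ℝ) (x : Euc n) : ℝ :=
  ‖gradient U x‖ ^ 2 / (Real.sqrt p + ‖x‖) ^ 2

/-- `c⁽⁰⁾_{U,p}(S) = inf_{x ∈ S} (p + U(x))/(p + |x|²)`. -/
def cLow {n : ℕ} (U : Euc n → ℝ) (p : ℝ) (S : Set (Euc n)) : ℝ := sInf (ratio0 U p '' S)

/-- `C⁽⁰⁾_{U,p}(S) = sup_{x ∈ S} (p + U(x))/(p + |x|²)`. -/
def cUp {n : ℕ} (U : Euc n → ℝ) (p : ℝ) (S : Set (Euc n)) : ℝ := sSup (ratio0 U p '' S)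

/-- `C⁽¹⁾_{U,p}(S) = sup_{x ∈ S} |∇U(x)|²/(√p + |x|)²`. -/
def cGrad {n : ℕ} (U : Euc n → ℝ) (p : ℝ) (S : Set (Euc n)) : ℝ := sSup (ratio1 U p '' S)

/-- The Lebesgue volume of the unit ball in `ℝⁿ`. -/
def unitBallVol (n : ℕ) : ℝ := (volume (ball (0 : Euc n) 1)).toReal

/-- `Θ_p(t) = p·log(1 + t/p)`. -/
def Theta (p t : ℝ) : ℝ := p * Real.log (1 + t / p)

/-- The Hessian matrix of `f` at `x` in the standard orthonormal basis of `ℝⁿ`. -/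
def hessMat {n : ℕ} (f : Euc n → ℝ) (x : Euc n) : Matrix (Fin n) (Fin n) ℝ :=
  Matrix.of fun i j =>
    iteratedFDeriv ℝ 2 f x ![EuclideanSpace.single i 1, EuclideanSpace.single j 1]

/-- Directional derivative. -/
def pd {n : ℕ} (v : Euc n) (f : Euc n → ℝ) (x : Euc n) : ℝ := fderiv ℝ f x v

lemma pd_smooth {n : ℕ} (v : Euc n) {f : Euc n → ℝ} (hf : ContDiff ℝ (⊤ : ℕ∞) f) :
    ContDiff ℝ (⊤ : ℕ∞) (pd v f) := by
  have h : ContDiff ℝ (⊤ : ℕ∞) (fderiv ℝ f) := hf.fderiv_right (by simp)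
  exact h.clm_apply contDiff_const

lemma snd_eq {n : ℕ} (v w : Euc n) {f : Euc n → ℝ} (hf : ContDiff ℝ (⊤ : ℕ∞) f) (x : Euc n) :
    pd v (pd w f) x = fderiv ℝ (fderiv ℝ f) x v w := by
  have h : ContDiff ℝ (⊤ : ℕ∞) (fderiv ℝ f) := hf.fderiv_right (by simp)
  have h1 : DifferentiableAt ℝ (fderiv ℝ f) x := (h.differentiable (by simp)) x
  have h2 := h1.hasFDerivAt.clm_apply (hasFDerivAt_const w x)
  unfold pd
  erw [h2.fderiv]
  simp

lemma pd_comm {n : ℕ} (v w : Euc n) {f : Euc n → ℝ} (hf : ContDiff ℝ (⊤ : ℕ∞) f) :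
    pd v (pd w f) = pd w (pd v f) := by
  funext x
  rw [snd_eq v w hf, snd_eq w v hf]
  have : ContDiffAt ℝ 2 f x := (hf.of_le (WithTop.coe_le_coe.2 (le_top : (2:ℕ∞) ≤ ⊤))).contDiffAt
  exact (this.isSymmSndFDerivAt (by simp)) v w

lemma hess_eq {n : ℕ} {f : Euc n → ℝ} (hf : ContDiff ℝ (⊤ : ℕ∞) f) (x v : Euc n) :
    hess f x v = pd v (pd v f) x := by
  rw [snd_eq v v hf, hess, iteratedFDeriv_two_apply]; simp

lemma pd_line {n : ℕ} {f : Euc n → ℝ} (hf : ContDiff ℝ (⊤ : ℕ∞) f) (x v : Euc n) (t : ℝ) :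
    HasDerivAt (fun s : ℝ => f (x + s • v)) (pd v f (x + t • v)) t := by
  have h1 : HasFDerivAt f (fderiv ℝ f (x + t • v)) (x + t • v) :=
    (hf.differentiable (by simp) _).hasFDerivAt
  have h2 : HasDerivAt (fun s : ℝ => x + s • v) v t := by
    simpa using ((hasDerivAt_id t).smul_const v).const_add x
  exact h1.comp_hasDerivAt t h2

lemma second_nonneg {f f' : ℝ → ℝ} {c : ℝ} (h : ∀ t, HasDerivAt f (f' t) t)
    (h2 : HasDerivAt f' c 0) (hmin : ∀ t, f 0 ≤ f t) : 0 ≤ c := by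
  by_contra hc
  push Not at hc
  have e1 : deriv f = f' := funext fun t => (h t).deriv
  have hlm : IsLocalMin f 0 := Filter.Eventually.of_forall hmin
  have hM : IsLocalMax f 0 := by
    apply isLocalMax_of_deriv_deriv_neg
    · rw [e1, h2.deriv]; exact hc
    · exact hlm.deriv_eq_zero
    · exact (h 0).continuousAt
  have hcst : f =ᶠ[nhds 0] fun _ => f 0 := by
    filter_upwards [hM] with t ht
    exact le_antisymm ht (hmin t)
  have h3 : f' =ᶠ[nhds 0] fun _ => (0 : ℝ) := by
    have := hcst.deriv
    rw [e1] at this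
    simpa using this
  have := h3.deriv_eq
  rw [h2.deriv] at this
  simp at this
  linarith

lemma hess_nonneg {n : ℕ} {f : Euc n → ℝ} (hf : ContDiff ℝ (⊤ : ℕ∞) f)
    (hc : ConvexOn ℝ univ f) (x v : Euc n) : 0 ≤ pd v (pd v f) x := by
  have h1 : ∀ t : ℝ, HasDerivAt (fun s : ℝ => f (x + s • v) + f (x + (-s) • v))
      (pd v f (x + t • v) - pd v f (x + (-t) • v)) t := by
    intro t
    have := (pd_line hf x v (-t)).scomp t (hasDerivAt_neg t)
    have := (pd_line hf x v t).add this
    refine this.congr_deriv ?_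
    simp; ring
  have h2 : HasDerivAt (fun t : ℝ => pd v f (x + t • v) - pd v f (x + (-t) • v))
      (2 * pd v (pd v f) x) 0 := by
    have a := (pd_line (pd_smooth v hf) x v (-0)).scomp (0:ℝ) (hasDerivAt_neg (0:ℝ))
    have := (pd_line (pd_smooth v hf) x v 0).sub a
    refine this.congr_deriv ?_
    simp; ring
  have := second_nonneg h1 h2 (fun t => by
    have := hc.2 (mem_univ (x + t • v)) (mem_univ (x + (-t) • v)) (show (0:ℝ) ≤ 1/2 by norm_num)
      (show (0:ℝ) ≤ 1/2 by norm_num) (by norm_num)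
    have e : (1/2 : ℝ) • (x + t • v) + (1/2 : ℝ) • (x + (-t) • v) = x := by module
    rw [e] at this
    simp only [smul_eq_mul] at this
    simp only [neg_zero, zero_smul, add_zero]
    linarith)
  linarith

lemma snd_nonpos_of_max {n : ℕ} {f : Euc n → ℝ} (hf : ContDiff ℝ (⊤ : ℕ∞) f)
    (x v : Euc n) (hx : ∀ y, f y ≤ f x) : pd v (pd v f) x ≤ 0 := by
  have := second_nonneg (f := fun t => - f (x + t • v)) (fun t => (pd_line hf x v t).neg)
    (pd_line (pd_smooth v hf) x v 0).neg (fun t => by simpa using hx _)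
  simpa using this

lemma hess_mat {n : ℕ} {f : Euc n → ℝ} (hf : ContDiff ℝ (⊤ : ℕ∞) f) (x : Euc n)
    (c : Fin n → ℝ) :
    pd (WithLp.toLp 2 c) (pd (WithLp.toLp 2 c) f) x = c ⬝ᵥ (hessMat f x).mulVec c := by
  have e : (WithLp.toLp 2 c : Euc n) = ∑ j, c j • EuclideanSpace.single j (1:ℝ) := by
    ext i
    simp [Pi.single_apply]
  rw [snd_eq _ _ hf, e]
  simp only [map_sum, map_smul, _root_.sum_apply, _root_.smul_apply,
    smul_eq_mul, dotProduct, Matrix.mulVec, hessMat, Matrix.of_apply, iteratedFDeriv_two_apply,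
    Matrix.cons_val_zero, Matrix.cons_val_one, Finset.mul_sum]
  rw [Finset.sum_comm]
  refine Finset.sum_congr rfl fun i _ => Finset.sum_congr rfl fun j _ => ?_
  ring

lemma hessMat_psd {n : ℕ} {f : Euc n → ℝ} (hf : ContDiff ℝ (⊤ : ℕ∞) f)
    (hc : ConvexOn ℝ univ f) (x : Euc n) : (hessMat f x).PosSemidef := by
  refine .of_dotProduct_mulVec_nonneg ?_ ?_
  · ext i j
    simp only [hessMat, Matrix.conjTranspose_apply, Matrix.of_apply, iteratedFDeriv_two_apply,
      Matrix.cons_val_zero, Matrix.cons_val_one, star_trivial]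
    rw [← snd_eq _ _ hf, ← snd_eq _ _ hf, pd_comm _ _ hf]
  · intro c
    have := hess_nonneg hf hc x (WithLp.toLp 2 c)
    rw [hess_mat hf] at this
    simpa using this

open scoped MatrixOrder in
lemma mat_amgm {n : ℕ} (hn : 1 ≤ n) (A : Matrix (Fin n) (Fin n) ℝ) (hA : A.PosSemidef)
    (hdet : A.det ≠ 0) :
    ∃ C : Fin n → Fin n → ℝ, (∑ i, C i ⬝ᵥ A.mulVec (C i) = n) ∧
      ∀ B : Matrix (Fin n) (Fin n) ℝ, B.PosSemidef →
        n * (B.det / A.det) ^ (1 / (n:ℝ)) ≤ ∑ i, C i ⬝ᵥ B.mulVec (C i) := by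
  obtain ⟨Y, hY⟩ := CStarAlgebra.nonneg_iff_eq_star_mul_self.mp hA.nonneg
  rw [Matrix.star_eq_conjTranspose] at hY
  have hdA : A.det = Y.det * Y.det := by rw [hY]; simp
  have hYd : IsUnit Y.det := by
    rw [isUnit_iff_ne_zero]; intro h; apply hdet; rw [hdA, h]; simp
  have key : ∀ B : Matrix (Fin n) (Fin n) ℝ,
      ∑ i, (fun j => Y⁻¹ j i) ⬝ᵥ B.mulVec (fun j => Y⁻¹ j i)
        = (Y⁻¹.conjTranspose * B * Y⁻¹).trace := by
    intro B
    rw [Matrix.mul_assoc]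
    simp [Matrix.trace, Matrix.mul_apply, dotProduct, Matrix.mulVec]
  refine ⟨fun i j => Y⁻¹ j i, ?_, ?_⟩
  · rw [key A]
    have : Y⁻¹.conjTranspose * A * Y⁻¹ = 1 := by
      rw [hY, Matrix.mul_assoc, Matrix.mul_assoc, Matrix.mul_nonsing_inv _ hYd, Matrix.mul_one,
        ← Matrix.conjTranspose_mul, Matrix.mul_nonsing_inv _ hYd, Matrix.conjTranspose_one]
    rw [this]; simp
  · intro B hB
    rw [key B]
    have hM := hB.conjTranspose_mul_mul_same Y⁻¹
    set M := Y⁻¹.conjTranspose * B * Y⁻¹ with hMdef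
    have hd : B.det / A.det = M.det := by
      rw [hMdef, hdA]
      simp only [Matrix.det_mul, Matrix.det_conjTranspose, star_trivial, Matrix.det_nonsing_inv,
        Ring.inverse_eq_inv']
      have := hYd.ne_zero
      field_simp
    rw [hd, hM.isHermitian.det_eq_prod_eigenvalues, hM.isHermitian.trace_eq_sum_eigenvalues]
    have hnpos : (0:ℝ) < n := by exact_mod_cast hn
    have := Real.geom_mean_le_arith_mean Finset.univ (fun _ => (1:ℝ)) hM.isHermitian.eigenvalues
      (by simp) (by simpa using hnpos) (fun i _ => hM.eigenvalues_nonneg i)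
    simp at this
    rw [le_div_iff₀ hnpos] at this
    simp
    linarith

lemma oned {N : ℝ} (hN : 0 < N) {L L' G G' : ℝ → ℝ} {L2 G2 : ℝ}
    (hL : ∀ t, HasDerivAt L (L' t) t) (hL2 : HasDerivAt L' L2 0)
    (hG : ∀ t, HasDerivAt G (G' t) t) (hG2 : HasDerivAt G' G2 0)
    (hle : ∀ t, N * Real.exp ((L t - L 0) / N) ≤ G t) (h0 : G 0 = N) :
    L2 + (L' 0) ^ 2 / N ≤ G2 := by
  have hE : ∀ t, HasDerivAt (fun t => Real.exp ((L t - L 0) / N))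
      (Real.exp ((L t - L 0) / N) * (L' t / N)) t := fun t =>
    (((hL t).sub_const (L 0)).div_const N).exp
  have h1 : ∀ t, HasDerivAt (fun t => G t - N * Real.exp ((L t - L 0) / N))
      (G' t - N * (Real.exp ((L t - L 0) / N) * (L' t / N))) t := fun t =>
    (hG t).sub ((hE t).const_mul N)
  have h2 := hG2.sub (((hE 0).mul (hL2.div_const N)).const_mul N)
  have := second_nonneg h1 h2 (fun t => by simpa [h0] using hle t)
  simp at this
  have e : N * (L' 0 / N * (L' 0 / N) + L2 / N) = L2 + (L' 0) ^ 2 / N := by field_simp; ring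
  linarith

lemma theta_deriv {p : ℝ} (hp : 0 < p) {u u' : ℝ → ℝ} {u2 : ℝ} (hu : ∀ t, -p < u t)
    (h : ∀ t, HasDerivAt u (u' t) t) (h2 : HasDerivAt u' u2 0) :
    (∀ t, HasDerivAt (fun t => Theta p (u t)) (p * u' t / (p + u t)) t) ∧
    HasDerivAt (fun t => p * u' t / (p + u t))
      (p / (p + u 0) * u2 - p * (u' 0 / (p + u 0)) ^ 2) 0 := by
  constructor
  · intro t
    have hpos : 0 < p + u t := by linarith [hu t]
    have hne : 1 + u t / p ≠ 0 := by
      have : 1 + u t / p = (p + u t) / p := by field_simp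
      rw [this]; positivity
    have := ((((h t).div_const p).const_add 1).log hne).const_mul p
    refine this.congr_deriv ?_
    have h3 := hpos.ne'
    field_simp
  · have hpos : 0 < p + u 0 := by linarith [hu 0]
    have := (h2.const_mul p).div ((h 0).const_add p) hpos.ne'
    refine this.congr_deriv ?_
    have h3 := hpos.ne'
    field_simp

lemma gradient_smooth {n : ℕ} {f : Euc n → ℝ} (hf : ContDiff ℝ (⊤ : ℕ∞) f) :
    ContDiff ℝ (⊤ : ℕ∞) (gradient f) := by
  have h : ContDiff ℝ (⊤ : ℕ∞) (fderiv ℝ f) := hf.fderiv_right (by simp)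
  exact (InnerProductSpace.toDual ℝ (Euc n)).symm.toContinuousLinearEquiv.contDiff.comp h

lemma inner_grad {n : ℕ} {f : Euc n → ℝ} (hf : ContDiff ℝ (⊤ : ℕ∞) f) (x v : Euc n) :
    ⟪gradient f x, v⟫ = pd v f x := by
  have := hf
  simp [pd, inner_gradient_left]

lemma inner_fderiv {n : ℕ} {H : Euc n → Euc n} (hH : ContDiff ℝ (⊤ : ℕ∞) H) (v : Euc n)
    {h : Euc n → ℝ} (hh : ∀ x, ⟪H x, v⟫ = h x) (e x : Euc n) :
    ⟪fderiv ℝ H x e, v⟫ = pd e h x := by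
  have h1 : HasFDerivAt H (fderiv ℝ H x) x := (hH.differentiable (by simp) x).hasFDerivAt
  have e1 : h = fun x => ⟪H x, v⟫ := funext fun x => (hh x).symm
  have h2 := h1.inner ℝ (hasFDerivAt_const v x)
  rw [e1, pd, h2.fderiv]
  simp [fderivInnerCLM_apply]

lemma field_line {n : ℕ} {H : Euc n → Euc n} (hf : ContDiff ℝ (⊤ : ℕ∞) H) (x v : Euc n) (t : ℝ) :
    HasDerivAt (fun s : ℝ => H (x + s • v)) (fderiv ℝ H (x + t • v) v) t := by
  have h1 : HasFDerivAt H (fderiv ℝ H (x + t • v)) (x + t • v) :=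
    (hf.differentiable (by simp) _).hasFDerivAt
  have h2 : HasDerivAt (fun s : ℝ => x + s • v) v t := by
    simpa using ((hasDerivAt_id t).smul_const v).const_add x
  exact h1.comp_hasDerivAt t h2

lemma eig {n : ℕ} {f : Euc n → ℝ} (hf : ContDiff ℝ (⊤ : ℕ∞) f) (x e : Euc n) (he : ‖e‖ = 1)
    (hmax : ∀ v : Euc n, ‖v‖ = 1 → hess f x v ≤ hess f x e) (w : Euc n) :
    pd e (pd w f) x = hess f x e * ⟪e, w⟫ := by
  set B := fderiv ℝ (fderiv ℝ f) x with hB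
  have hh : ∀ v, hess f x v = B v v := fun v => by rw [hess_eq hf, snd_eq _ _ hf]
  have hsym : B w e = B e w := by
    rw [hB, ← snd_eq _ _ hf, ← snd_eq _ _ hf, pd_comm _ _ hf]
  have hall : ∀ v, B v v ≤ hess f x e * ‖v‖ ^ 2 := by
    intro v
    by_cases hv : v = 0
    · simp [hv]
    have hv' : ‖v‖ ≠ 0 := norm_ne_zero_iff.mpr hv
    have := hmax (‖v‖⁻¹ • v) (by rw [norm_smul]; simp [hv'])
    rw [hh] at this
    simp only [map_smul, _root_.smul_apply, smul_eq_mul] at this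
    have h3 : B v v = ‖v‖⁻¹ * (‖v‖⁻¹ * B v v) * ‖v‖ ^ 2 := by field_simp
    rw [h3]
    exact mul_le_mul_of_nonneg_right this (by positivity)
  rw [snd_eq _ _ hf, ← hB]
  set l := hess f x e with hl
  have hle : B e e = l := by rw [hl, hh]
  have h1 : ∀ s : ℝ, HasDerivAt (fun s : ℝ => s * (2 * (l * ⟪e, w⟫ - B e w))
      + s ^ 2 * (l * ‖w‖ ^ 2 - B w w)) ((2 * (l * ⟪e, w⟫ - B e w))
      + (2 * s) * (l * ‖w‖ ^ 2 - B w w)) s := by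
    intro s
    have := ((hasDerivAt_id s).mul_const (2 * (l * ⟪e, w⟫ - B e w))).add
      (((hasDerivAt_id s).pow 2).mul_const (l * ‖w‖ ^ 2 - B w w))
    refine this.congr_deriv ?_
    simp
  have hmin : IsLocalMin (fun s : ℝ => s * (2 * (l * ⟪e, w⟫ - B e w))
      + s ^ 2 * (l * ‖w‖ ^ 2 - B w w)) 0 := by
    refine Filter.Eventually.of_forall fun s => ?_
    have := hall (e + s • w)
    rw [norm_add_sq_real, he, norm_smul, inner_smul_right] at this
    simp only [map_add, map_smul, _root_.add_apply, _root_.smul_apply, smul_eq_mul] at this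
    rw [hsym, hle, mul_pow, Real.norm_eq_abs, sq_abs] at this
    simp
    nlinarith
  have := hmin.hasDerivAt_eq_zero (h1 0)
  linarith

lemma final_alg {d D a b : ℝ} (hd : 0 < d) (hlt : d < D) :
    D * a ^ 2 - d * b ^ 2 - (D * a - d * b) ^ 2 / d ≤ d * b ^ 2 * ((2 * d - D) / (D - d)) := by
  have h : 0 < D - d := by linarith
  have e : d * b ^ 2 * ((2 * d - D) / (D - d)) -
      (D * a ^ 2 - d * b ^ 2 - (D * a - d * b) ^ 2 / d)
      = D / (d * (D - d)) * ((D - d) * a - d * b) ^ 2 := by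
    field_simp; ring
  have : 0 ≤ D / (d * (D - d)) * ((D - d) * a - d * b) ^ 2 := by
    have : 0 < D := by linarith
    positivity
  linarith

/-- **Alternative second-variation estimate for strictly ordered parameters** (`d < D`). -/
theorem alternative_second_variation
    {n : ℕ} (hn : 1 ≤ n) (d D : ℝ) (hnd : (n : ℝ) ≤ d) (hdD : d ≤ D)
    (V W : Euc n → ℝ) (hVreg : ContDiff ℝ (⊤ : ℕ∞) V) (hWreg : ContDiff ℝ (⊤ : ℕ∞) W)
    (hVlow : ∀ x, -d < V x) (hWlow : ∀ y, -D < W y)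
    (ZV ZW : ℝ) (hZV : 0 < ZV) (hZW : 0 < ZW)
    (φ : Euc n → ℝ) (hφreg : ContDiff ℝ (⊤ : ℕ∞) φ) (hφconv : ConvexOn ℝ univ φ)
    (hMA : ∀ x : Euc n, (ZV / ZW) ^ (1 / d) * (hessMat φ x).det ^ (1 / d)
      = Real.exp ((Theta D (W (gradient φ x)) - Theta d (V x)) / d))
    (xbar e1 : Euc n) (he1 : ‖e1‖ = 1)
    (hmax : ∀ (x e : Euc n), ‖e‖ = 1 → hess φ x e ≤ hess φ xbar e1)
    (ybar : Euc n) (hybar : ybar = gradient φ xbar)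
    (l V1 V11 W1 W11 Vb Wb : ℝ)
    (hl : l = hess φ xbar e1)
    (hV1 : V1 = ⟪gradient V xbar, e1⟫) (hV11 : V11 = hess V xbar e1)
    (hW1 : W1 = ⟪gradient W ybar, e1⟫) (hW11 : W11 = hess W ybar e1)
    (hVb : Vb = V xbar) (hWb : Wb = W ybar)
    (hlt : d < D) :
    D / (D + Wb) * W11 * l ^ 2
      ≤ d / (d + Vb) * V11 + d / (d + Vb) ^ 2 * max 0 ((2 * d - D) / (D - d)) * V1 ^ 2 := by
  have hNpos : (0:ℝ) < n := by exact_mod_cast hn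
  have hd0 : 0 < d := by linarith
  have hD0 : 0 < D := by linarith
  have hpsd := hessMat_psd hφreg hφconv
  set F : Euc n → ℝ := fun x => Theta D (W (gradient φ x)) - Theta d (V x) with hF
  have hdetpos : ∀ x, 0 < (hessMat φ x).det := by
    intro x
    refine lt_of_le_of_ne (hpsd x).det_nonneg fun h0 => ?_
    have := hMA x
    rw [← h0, Real.zero_rpow (by positivity), mul_zero] at this
    exact (Real.exp_pos _).ne this
  have hdet : ∀ x, ZV / ZW * (hessMat φ x).det = Real.exp (F x) := by
    intro x
    have hz : 0 ≤ ZV / ZW := by positivity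
    have h1 := hMA x
    rw [← Real.mul_rpow hz (hdetpos x).le] at h1
    have h2 := congrArg (fun y : ℝ => y ^ d) h1
    rw [← Real.rpow_mul (mul_nonneg hz (hdetpos x).le), ← Real.exp_mul] at h2
    rw [one_div_mul_cancel hd0.ne', Real.rpow_one, div_mul_cancel₀ _ hd0.ne'] at h2
    exact h2
  have hratio : ∀ x, (hessMat φ x).det / (hessMat φ xbar).det = Real.exp (F x - F xbar) := by
    intro x
    rw [Real.exp_sub, ← hdet, ← hdet]
    have := (hdetpos xbar).ne'
    field_simp
  obtain ⟨C, hC1, hC2⟩ := mat_amgm hn _ (hpsd xbar) (hdetpos xbar).ne'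
  set c : Fin n → Euc n := fun i => WithLp.toLp 2 (C i) with hc
  -- the maximal function
  set f11 := pd e1 (pd e1 φ) with hf11
  have hp1 := pd_smooth e1 hφreg
  have hp11 : ContDiff ℝ (⊤ : ℕ∞) f11 := pd_smooth e1 hp1
  have hf11max : ∀ y, f11 y ≤ f11 xbar := by
    intro y
    have := hmax y e1 he1
    rwa [hess_eq hφreg, hess_eq hφreg] at this
  have hswap : ∀ v, pd e1 (pd e1 (pd v φ)) = pd v f11 := by
    intro v
    rw [pd_comm e1 v hφreg, pd_comm e1 v hp1]
  have hswap2 : ∀ v, pd e1 (pd e1 (pd v (pd v φ))) = pd v (pd v f11) := by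
    intro v
    rw [pd_comm e1 v (pd_smooth v hφreg), pd_comm e1 v hφreg, pd_comm e1 v (pd_smooth v hp1),
      pd_comm e1 v hp1]
  have hgrad0 : ∀ v, pd v f11 xbar = 0 := by
    intro v
    have : IsLocalMax f11 xbar := Filter.Eventually.of_forall hf11max
    simp [pd, this.fderiv_eq_zero]
  -- trace function
  have hGd : ∀ t : ℝ, HasDerivAt (fun s : ℝ => ∑ i, pd (c i) (pd (c i) φ) (xbar + s • e1))
      (∑ i, pd e1 (pd (c i) (pd (c i) φ)) (xbar + t • e1)) t := fun t =>
    HasDerivAt.fun_sum fun i _ => pd_line (pd_smooth _ (pd_smooth _ hφreg)) xbar e1 t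
  have hGd2 : HasDerivAt (fun s : ℝ => ∑ i, pd e1 (pd (c i) (pd (c i) φ)) (xbar + s • e1))
      (∑ i, pd e1 (pd e1 (pd (c i) (pd (c i) φ))) (xbar + (0:ℝ) • e1)) 0 :=
    HasDerivAt.fun_sum fun i _ =>
      pd_line (pd_smooth _ (pd_smooth _ (pd_smooth _ hφreg))) xbar e1 0
  have hG2 : (∑ i, pd e1 (pd e1 (pd (c i) (pd (c i) φ))) (xbar + (0:ℝ) • e1)) ≤ 0 := by
    refine Finset.sum_nonpos fun i _ => ?_
    rw [hswap2, zero_smul, add_zero]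
    exact snd_nonpos_of_max hp11 _ _ hf11max
  -- gradient curve
  have hg0 := gradient_smooth hφreg
  set g1 : Euc n → Euc n := fun x => fderiv ℝ (gradient φ) x e1 with hg1
  have hg1s : ContDiff ℝ (⊤ : ℕ∞) g1 := (hg0.fderiv_right (by simp)).clm_apply contDiff_const
  have hig1 : ∀ v x, ⟪g1 x, v⟫ = pd e1 (pd v φ) x := fun v x =>
    inner_fderiv hg0 v (fun y => inner_grad hφreg y v) e1 x
  have hig2 : ∀ v x, ⟪fderiv ℝ g1 x e1, v⟫ = pd v f11 x := fun v x => by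
    rw [inner_fderiv hg1s v (hig1 v) e1 x, hswap]
  have hg1x : g1 xbar = l • e1 := by
    refine ext_inner_right ℝ fun v => ?_
    rw [hig1, eig hφreg xbar e1 he1 (fun v hv => hmax xbar v hv), inner_smul_left, hl]
    simp
  have hg2x : fderiv ℝ g1 xbar e1 = 0 := by
    refine ext_inner_right ℝ fun v => ?_
    rw [hig2, hgrad0, inner_zero_left]
  have hWf : ContDiff ℝ (⊤ : ℕ∞) (fderiv ℝ W) := hWreg.fderiv_right (by simp)
  have hw : ∀ t : ℝ, HasDerivAt (fun s : ℝ => W (gradient φ (xbar + s • e1)))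
      (fderiv ℝ W (gradient φ (xbar + t • e1)) (g1 (xbar + t • e1))) t := fun t =>
    (hWreg.differentiable (by simp) _).hasFDerivAt.comp_hasDerivAt t (field_line hg0 xbar e1 t)
  have hw2 : HasDerivAt (fun t : ℝ =>
      fderiv ℝ W (gradient φ (xbar + t • e1)) (g1 (xbar + t • e1))) (l ^ 2 * W11) 0 := by
    have a := (hWf.differentiable (by simp) _).hasFDerivAt.comp_hasDerivAt (0:ℝ)
      (field_line hg0 xbar e1 0)
    have b := a.clm_apply (field_line hg1s xbar e1 0)
    refine b.congr_deriv ?_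
    simp only [Function.comp, zero_smul, add_zero]
    have hg1x' : fderiv ℝ (gradient φ) xbar e1 = l • e1 := hg1x
    rw [hg2x, hg1x, hg1x', hW11, hess_eq hWreg, snd_eq _ _ hWreg, hybar]
    simp only [map_smul, _root_.smul_apply, smul_eq_mul, map_zero]
    ring
  have hv : ∀ t : ℝ, HasDerivAt (fun s : ℝ => V (xbar + s • e1)) (pd e1 V (xbar + t • e1)) t :=
    pd_line hVreg xbar e1
  have hv2 : HasDerivAt (fun s : ℝ => pd e1 V (xbar + s • e1)) V11 0 := by
    refine (pd_line (pd_smooth e1 hVreg) xbar e1 0).congr_deriv ?_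
    rw [hV11, hess_eq hVreg]; simp
  obtain ⟨tw1, tw2⟩ := theta_deriv hD0 (fun t => hWlow _) hw hw2
  obtain ⟨tv1, tv2⟩ := theta_deriv hd0 (fun t => hVlow _) hv hv2
  have main := oned hNpos (fun t => (tw1 t).fun_sub (tv1 t)) (tw2.fun_sub tv2) hGd hGd2
    (fun t => by
      have h1 := hC2 _ (hpsd (xbar + t • e1))
      rw [hratio, ← Real.exp_mul] at h1
      simp only [hc, hess_mat hφreg]
      refine le_trans (le_of_eq ?_) h1
      simp only [hF, zero_smul, add_zero, mul_one_div])
    (by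
      simp only [hc, hess_mat hφreg, zero_smul, add_zero]
      exact hC1)
  simp only [zero_smul, add_zero] at main hG2
  have eV1 : pd e1 V xbar = V1 := by rw [hV1, inner_grad hVreg]
  have eW1 : fderiv ℝ W (gradient φ xbar) (g1 xbar) = l * W1 := by
    rw [hg1x, hW1, inner_grad hWreg, hybar, pd, map_smul, smul_eq_mul]
  rw [eV1, eW1, ← hybar, ← hWb, ← hVb] at main
  set a := l * W1 / (D + Wb) with ha
  set b := V1 / (d + Vb) with hb
  have ea : D * (l * W1) / (D + Wb) = D * a := by rw [ha]; ring
  have eb : d * V1 / (d + Vb) = d * b := by rw [hb]; ring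
  rw [ea, eb] at main
  have hnd' : (D * a - d * b) ^ 2 / d ≤ (D * a - d * b) ^ 2 / n :=
    div_le_div_of_nonneg_left (sq_nonneg _) hNpos hnd
  have halg := final_alg (a := a) (b := b) hd0 hlt
  have hmx : d * b ^ 2 * ((2 * d - D) / (D - d)) ≤ d * b ^ 2 * max 0 ((2 * d - D) / (D - d)) :=
    mul_le_mul_of_nonneg_left (le_max_right _ _) (by positivity)
  have e3 : d / (d + Vb) ^ 2 * max 0 ((2 * d - D) / (D - d)) * V1 ^ 2
      = d * b ^ 2 * max 0 ((2 * d - D) / (D - d)) := by rw [hb, div_pow]; ring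
  rw [e3]
  have e4 : D / (D + Wb) * W11 * l ^ 2 = D / (D + Wb) * (l ^ 2 * W11) := by ring
  rw [e4]
  linarith
end
end

section
/- Global linear growth estimate for the transport map. Let n ≥ 1 be an integer and d, D reals with n ≤ d ≤ D < ∞. Let V, W : ℝⁿ → ℝ be continuous with V > −d and W > −D pointwise and Z_{V,d}, Z_{W,D} finite, and assume the global constants c⁽⁰⁾_{V,d}, C⁽⁰⁾_{V,d}, c⁽⁰⁾_{W,D}, C⁽⁰⁾_{W,D} satisfy 0 < c⁽⁰⁾_{V,d} ≤ C⁽⁰⁾_{V,d} < ∞ and 0 < c⁽⁰⁾_{W,D} ≤ C⁽⁰⁾_{W,D} < ∞. Let φ : ℝⁿ → ℝ be convex and differentiable with (∇φ)_# μ_{V,d} = μ_{W,D}. Define I_p = ∫_{ℝⁿ}(1 + |z|²/p)^{−p} dz, K = 3·[ (C⁽⁰⁾_{V,d}/c⁽⁰⁾_{V,d})^d · (C⁽⁰⁾_{W,D}/c⁽⁰⁾_{W,D})^D · (5/4)^d · 10^{2d} · 3^{−n} · (D/d)^D · I_d/I_D ]^{1/(2D−n)}, and M = (d/D)·K². Then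 for every x ∈ ℝⁿ: |∇φ(x)| ≤ K·max{|x|, √d}, and consequently D + |∇φ(x)|² ≤ (D/d)·(1 + M)·(d + |x|²). -/
open MeasureTheory Metric Set
open scoped ENNReal RealInnerProductSpace

noncomputable section

/-- `I_p = ∫_{ℝⁿ} (1 + |z|²/p)^(−p) dz`. -/
def Ipol (n : ℕ) (p : ℝ) : ℝ := ∫ z : Euc n, (1 + ‖z‖ ^ 2 / p) ^ (-p)

lemma grad_mono {n : ℕ} (φ : Euc n → ℝ) (hφconv : ConvexOn ℝ univ φ)
    (hφdiff : Differentiable ℝ φ) (x v : Euc n) :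
    ⟪gradient φ x, v⟫ ≤ ⟪gradient φ (x + v), v⟫ := by
  have hin : ∀ z w : Euc n, ⟪gradient φ z, w⟫ = fderiv ℝ φ z w := by
    intro z w
    simp [gradient]
  have hline : ∀ t : ℝ, HasDerivAt (fun t : ℝ => x + t • v) v t := by
    intro t
    simpa using ((hasDerivAt_id t).smul_const v).const_add x
  have hd : ∀ t : ℝ, HasDerivAt (fun t : ℝ => φ (x + t • v)) (fderiv ℝ φ (x + t • v) v) t := by
    intro t
    exact (hφdiff (x + t • v)).hasFDerivAt.comp_hasDerivAt t (hline t)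
  have hconv : ConvexOn ℝ univ (fun t : ℝ => φ (x + t • v)) := by
    have := hφconv.comp_affineMap (AffineMap.lineMap x (x + v) : ℝ →ᵃ[ℝ] Euc n)
    have e : φ ∘ (AffineMap.lineMap x (x + v) : ℝ →ᵃ[ℝ] Euc n) = fun t : ℝ => φ (x + t • v) := by
      funext t
      simp [AffineMap.lineMap_apply, add_comm]
    rw [e] at this
    simpa using this
  have h1 := hconv.le_slope_of_hasDerivAt (mem_univ 0) (mem_univ 1) one_pos (hd 0)
  have h2 := hconv.slope_le_of_hasDerivAt (mem_univ 0) (mem_univ 1) one_pos (hd 1)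
  have := h1.trans h2
  rw [hin, hin]
  simpa using this

lemma grad_meas {n : ℕ} (φ : Euc n → ℝ) : Measurable (fun x => gradient φ x) := by
  unfold gradient
  exact (InnerProductSpace.toDual ℝ (Euc n)).symm.continuous.measurable.comp
    (measurable_fderiv ℝ φ)

lemma growth_on_ball {n : ℕ} (φ : Euc n → ℝ) (hφconv : ConvexOn ℝ univ φ)
    (hφdiff : Differentiable ℝ φ) (x0 : Euc n) (hr : 0 < ‖gradient φ x0‖) (R : ℝ) (hR : 0 < R)
    (hx0 : ‖x0‖ ≤ R) :
    ∃ c : Euc n, ∀ x ∈ closedBall c (3 * R), ‖x‖ ≤ 10 * R ∧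
      ‖gradient φ x0‖ / 3 ≤ ‖gradient φ x‖ := by
  set y := gradient φ x0 with hy
  set r := ‖y‖ with hrdef
  set e : Euc n := (6 * R / r) • y with he
  have hen : ‖e‖ = 6 * R := by
    rw [he, norm_smul, Real.norm_of_nonneg (by positivity), ← hrdef]
    field_simp
  refine ⟨x0 + e, fun x hx => ?_⟩
  obtain ⟨w, rfl⟩ : ∃ w, x = x0 + (e + w) := ⟨x - x0 - e, by abel⟩
  have hw : ‖w‖ ≤ 3 * R := by
    rw [mem_closedBall, dist_eq_norm] at hx
    have e1 : x0 + (e + w) - (x0 + e) = w := by abel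
    rwa [e1] at hx
  have hew : ‖e + w‖ ≤ 9 * R := (norm_add_le _ _).trans (by linarith)
  refine ⟨(norm_add_le _ _).trans (by linarith), ?_⟩
  have h1 := grad_mono φ hφconv hφdiff x0 (e + w)
  rw [← hy] at h1
  have h2 : ⟪gradient φ (x0 + (e + w)), e + w⟫ ≤ ‖gradient φ (x0 + (e + w))‖ * (9 * R) :=
    (real_inner_le_norm _ _).trans (by gcongr)
  have h3 : ⟪y, e⟫ = 6 * R * r := by
    rw [he, inner_smul_right, real_inner_self_eq_norm_sq, ← hrdef]
    field_simp
  have h4 : -(r * (3 * R)) ≤ ⟪y, w⟫ := by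
    have := abs_real_inner_le_norm y w
    have h5 : ‖y‖ * ‖w‖ ≤ r * (3 * R) := by gcongr
    linarith [neg_abs_le ⟪y, w⟫]
  rw [inner_add_right, h3] at h1
  have h6 : R * (3 * r) ≤ R * (9 * ‖gradient φ (x0 + (e + w))‖) := by nlinarith
  have := le_of_mul_le_mul_left h6 hR
  linarith

lemma tail_bound {n : ℕ} (hn : 1 ≤ n) (D : ℝ) (hD : (n : ℝ) ≤ D) (ρ : ℝ) (hρ : 0 < ρ)
    (hint : Integrable fun z : Euc n => (1 + ‖z‖ ^ 2 / D) ^ (-D)) :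
    ∫ z in {z : Euc n | ρ ≤ ‖z‖}, (1 + ‖z‖ ^ 2 / D) ^ (-D) ≤
      D ^ D * unitBallVol n * ρ ^ (n - 2 * D) := by
  have hn1 : (1 : ℝ) ≤ n := by exact_mod_cast hn
  have hD0 : 0 < D := by linarith
  have : Nonempty (Fin n) := ⟨⟨0, hn⟩⟩
  have hS : MeasurableSet {z : Euc n | ρ ≤ ‖z‖} := measurableSet_le measurable_const measurable_norm
  set f : ℝ → ℝ := (Ici ρ).indicator (fun t => t ^ (-(2 * D))) with hf
  have hfn : ∀ y ∈ Ioi (0 : ℝ), y ^ (Module.finrank ℝ (Euc n) - 1) • f y =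
      (Ici ρ).indicator (fun t => t ^ ((n : ℝ) - 1 - 2 * D)) y := by
    intro y hy
    have hy : 0 < y := hy
    by_cases h : y ∈ Ici ρ
    · rw [hf, indicator_of_mem h, indicator_of_mem h, finrank_euclideanSpace_fin, smul_eq_mul,
        ← Real.rpow_natCast, ← Real.rpow_add hy, Nat.cast_sub hn]
      congr 1
      push_cast
      ring
    · rw [hf, indicator_of_notMem h, indicator_of_notMem h, smul_zero]
  have hlt : (n : ℝ) - 1 - 2 * D < -1 := by linarith
  have hfi : Integrable (fun z : Euc n => f ‖z‖) := by
    rw [integrable_fun_norm_addHaar volume (f := f), integrableOn_congr_fun hfn measurableSet_Ioi]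
    apply Integrable.integrableOn
    rw [integrable_indicator_iff measurableSet_Ici, integrableOn_Ici_iff_integrableOn_Ioi]
    exact integrableOn_Ioi_rpow_of_lt hlt hρ
  have hval : ∫ z : Euc n, f ‖z‖ = n * (unitBallVol n * (ρ ^ (n - 2 * D) / (2 * D - n))) := by
    rw [integral_fun_norm_addHaar volume f, setIntegral_congr_fun measurableSet_Ioi hfn,
      setIntegral_indicator measurableSet_Ici]
    have : Ioi (0:ℝ) ∩ Ici ρ = Ici ρ := by
      ext t
      simp only [mem_inter_iff, mem_Ioi, mem_Ici]
      exact ⟨fun h => h.2, fun h => ⟨hρ.trans_le h, h⟩⟩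
    rw [this, integral_Ici_eq_integral_Ioi, integral_Ioi_rpow_of_lt hlt hρ]
    have e : (n : ℝ) - 1 - 2 * D + 1 = n - 2 * D := by ring
    rw [e, finrank_euclideanSpace_fin, neg_div, ← div_neg, neg_sub]
    simp [unitBallVol, Measure.real]
  have hle : ∀ z : Euc n, {z : Euc n | ρ ≤ ‖z‖}.indicator (fun z => (1 + ‖z‖ ^ 2 / D) ^ (-D)) z ≤
      D ^ D * f ‖z‖ := by
    intro z
    by_cases h : ρ ≤ ‖z‖
    · have hz : 0 < ‖z‖ := hρ.trans_le h
      rw [indicator_of_mem (show z ∈ {z : Euc n | ρ ≤ ‖z‖} from h), hf,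
        indicator_of_mem (show ‖z‖ ∈ Ici ρ from h)]
      have h1 : (1 + ‖z‖ ^ 2 / D) ^ (-D) ≤ (‖z‖ ^ 2 / D) ^ (-D) :=
        Real.rpow_le_rpow_of_nonpos (by positivity) (by linarith) (by linarith)
      refine h1.trans (le_of_eq ?_)
      rw [Real.div_rpow (by positivity) hD0.le, ← Real.rpow_natCast, ← Real.rpow_mul hz.le,
        Real.rpow_neg hD0.le D, div_inv_eq_mul, mul_comm]
      congr 2
      push_cast
      ring
    · rw [indicator_of_notMem (show z ∉ {z : Euc n | ρ ≤ ‖z‖} from h), hf,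
        indicator_of_notMem (show ‖z‖ ∉ Ici ρ from h), mul_zero]
  rw [← integral_indicator hS]
  refine (integral_mono (hint.indicator hS) (hfi.const_mul _) hle).trans ?_
  rw [integral_const_mul, hval, mul_assoc]
  have hu : 0 ≤ unitBallVol n := ENNReal.toReal_nonneg
  refine mul_le_mul_of_nonneg_left ?_ (by positivity)
  have h2 : (n : ℝ) / (2 * D - n) ≤ 1 := (div_le_one (by linarith)).2 (by linarith)
  have h3 : 0 ≤ unitBallVol n * ρ ^ (n - 2 * D) := by positivity
  calc _ = n / (2 * D - n) * (unitBallVol n * ρ ^ (n - 2 * D)) := by ring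
    _ ≤ 1 * (unitBallVol n * ρ ^ (n - 2 * D)) := by gcongr
    _ = _ := one_mul _

lemma ball_bound {n : ℕ} (d : ℝ) (hd : 0 < d) (R : ℝ) (hR : 0 < R) (hRd : d ≤ R ^ 2)
    (c : Euc n) (hc : ∀ x ∈ closedBall c (3 * R), ‖x‖ ≤ 10 * R)
    (hint : Integrable fun z : Euc n => (1 + ‖z‖ ^ 2 / d) ^ (-d)) :
    (125 * R ^ 2 / d) ^ (-d) * ((3 * R) ^ n * unitBallVol n) ≤
      ∫ z in closedBall c (3 * R), (1 + ‖z‖ ^ 2 / d) ^ (-d) := by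
  have hle : ∀ z ∈ closedBall c (3 * R), (125 * R ^ 2 / d) ^ (-d) ≤ (1 + ‖z‖ ^ 2 / d) ^ (-d) := by
    intro z hz
    apply Real.rpow_le_rpow_of_nonpos (by positivity) _ (by linarith)
    have := hc z hz
    have h2 : ‖z‖ ^ 2 ≤ (10 * R) ^ 2 := by gcongr
    rw [show 1 + ‖z‖ ^ 2 / d = (d + ‖z‖ ^ 2) / d by field_simp]
    gcongr
    nlinarith
  have hfin : volume (closedBall c (3 * R)) ≠ ⊤ := measure_closedBall_lt_top.ne
  have := setIntegral_mono_on (integrableOn_const hfin) hint.integrableOn measurableSet_closedBall hle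
  rw [setIntegral_const, smul_eq_mul, Measure.addHaar_real_closedBall _ _ (by positivity),
    finrank_euclideanSpace_fin] at this
  rw [mul_comm]
  exact this

structure Bds {n : ℕ} (U : Euc n → ℝ) (p c C : ℝ) : Prop where
  c0 : 0 < c
  C0 : 0 < C
  low : ∀ x, C ^ (-p) * (1 + ‖x‖ ^ 2 / p) ^ (-p) ≤ (1 + U x / p) ^ (-p)
  up : ∀ x, (1 + U x / p) ^ (-p) ≤ c ^ (-p) * (1 + ‖x‖ ^ 2 / p) ^ (-p)
  inth : Integrable fun z : Euc n => (1 + ‖z‖ ^ 2 / p) ^ (-p)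
  I0 : 0 < Ipol n p
  Z0 : 0 < Znorm U p
  Zlow : C ^ (-p) * Ipol n p ≤ Znorm U p
  Zup : Znorm U p ≤ c ^ (-p) * Ipol n p
  meas : ∀ S : Set (Euc n), MeasurableSet S →
    muUP U p S = ENNReal.ofReal (∫ x in S, (Znorm U p)⁻¹ * (1 + U x / p) ^ (-p))

lemma bds {n : ℕ} (U : Euc n → ℝ) (p : ℝ) (hp : 0 < p) (hcont : Continuous U)
    (hlow : ∀ x, -p < U x)
    (hZ : Integrable fun x : Euc n => (1 + U x / p) ^ (-p))
    (hc : 0 < cLow U p univ) (hcC : cLow U p univ ≤ cUp U p univ)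
    (hB : BddAbove (range (ratio0 U p))) : Bds U p (cLow U p univ) (cUp U p univ) := by
  have hpos : ∀ x, 0 < 1 + U x / p := by
    intro x
    have := hlow x
    rw [show 1 + U x / p = (p + U x) / p by field_simp]
    exact div_pos (by linarith) hp
  have hpos2 : ∀ x : Euc n, 0 < 1 + ‖x‖ ^ 2 / p := fun x => by positivity
  have hr : ∀ x, 1 + U x / p = ratio0 U p x * (1 + ‖x‖ ^ 2 / p) := by
    intro x
    unfold ratio0
    have : p + ‖x‖ ^ 2 ≠ 0 := by positivity
    field_simp
  have hr0 : ∀ x, 0 < ratio0 U p x := fun x =>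
    div_pos (by linarith [hlow x]) (by positivity)
  have h1 : ∀ x, cLow U p univ ≤ ratio0 U p x := fun x =>
    csInf_le ⟨0, by rintro _ ⟨y, -, rfl⟩; exact (hr0 y).le⟩ ⟨x, mem_univ x, rfl⟩
  have h2 : ∀ x, ratio0 U p x ≤ cUp U p univ := fun x =>
    le_csSup (by rwa [image_univ]) ⟨x, mem_univ x, rfl⟩
  have hC := hc.trans_le hcC
  set c := cLow U p univ
  set C := cUp U p univ
  have low : ∀ x, C ^ (-p) * (1 + ‖x‖ ^ 2 / p) ^ (-p) ≤ (1 + U x / p) ^ (-p) := by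
    intro x
    rw [← Real.mul_rpow hC.le (hpos2 x).le]
    refine Real.rpow_le_rpow_of_nonpos (hpos x) ?_ (by linarith)
    rw [hr]
    exact mul_le_mul_of_nonneg_right (h2 x) (hpos2 x).le
  have up : ∀ x, (1 + U x / p) ^ (-p) ≤ c ^ (-p) * (1 + ‖x‖ ^ 2 / p) ^ (-p) := by
    intro x
    rw [← Real.mul_rpow hc.le (hpos2 x).le]
    refine Real.rpow_le_rpow_of_nonpos (mul_pos hc (hpos2 x)) ?_ (by linarith)
    rw [hr]
    exact mul_le_mul_of_nonneg_right (h1 x) (hpos2 x).le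
  have hCp : 0 < C ^ (-p) := Real.rpow_pos_of_pos hC _
  have hch : Continuous fun z : Euc n => (1 + ‖z‖ ^ 2 / p) ^ (-p) :=
    Continuous.rpow_const (by fun_prop) fun x => Or.inl (hpos2 x).ne'
  have inth : Integrable fun z : Euc n => (1 + ‖z‖ ^ 2 / p) ^ (-p) := by
    refine (hZ.const_mul (C ^ (-p))⁻¹).mono' hch.aestronglyMeasurable (.of_forall fun x => ?_)
    rw [Real.norm_of_nonneg (Real.rpow_nonneg (hpos2 x).le _), inv_mul_eq_div, le_div_iff₀' hCp]
    exact low x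
  have I0 : 0 < Ipol n p := by
    unfold Ipol
    rw [integral_pos_iff_support_of_nonneg (fun x => Real.rpow_nonneg (hpos2 x).le _) inth]
    have hs : Function.support (fun z : Euc n => (1 + ‖z‖ ^ 2 / p) ^ (-p)) = univ :=
      eq_univ_of_forall fun x => (Real.rpow_pos_of_pos (hpos2 x) _).ne'
    rw [hs]
    exact isOpen_univ.measure_pos volume univ_nonempty
  have Zlow : C ^ (-p) * Ipol n p ≤ Znorm U p := by
    unfold Ipol Znorm
    rw [← integral_const_mul]
    exact integral_mono (inth.const_mul _) hZ low
  have Zup : Znorm U p ≤ c ^ (-p) * Ipol n p := by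
    unfold Ipol Znorm
    rw [← integral_const_mul]
    exact integral_mono hZ (inth.const_mul _) up
  have Z0 : 0 < Znorm U p := (mul_pos hCp I0).trans_le Zlow
  refine ⟨hc, hC, low, up, inth, I0, Z0, Zlow, Zup, fun S hS => ?_⟩
  unfold muUP
  rw [withDensity_apply _ hS, ofReal_integral_eq_lintegral_ofReal]
  · exact (hZ.const_mul _).integrableOn
  · exact .of_forall fun x => mul_nonneg (inv_nonneg.2 Z0.le) (Real.rpow_nonneg (hpos x).le _)

lemma Bds.lower {n : ℕ} {U : Euc n → ℝ} {p c C : ℝ} (h : Bds U p c C)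
    (hZ : Integrable fun x : Euc n => (1 + U x / p) ^ (-p)) (S : Set (Euc n))
    (b : ℝ) (hb0 : 0 ≤ b) (hb : b ≤ ∫ z in S, (1 + ‖z‖ ^ 2 / p) ^ (-p)) :
    (c / C) ^ p * (Ipol n p)⁻¹ * b ≤ ∫ x in S, (Znorm U p)⁻¹ * (1 + U x / p) ^ (-p) := by
  have hc := h.c0
  have hC := h.C0
  have h1 : C ^ (-p) * ∫ z in S, (1 + ‖z‖ ^ 2 / p) ^ (-p) ≤ ∫ x in S, (1 + U x / p) ^ (-p) := by
    rw [← integral_const_mul]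
    exact integral_mono (h.inth.const_mul _).integrableOn hZ.integrableOn h.low
  have hCp : 0 < C ^ (-p) := Real.rpow_pos_of_pos hC _
  have hcp : 0 < c ^ (-p) := Real.rpow_pos_of_pos hc _
  rw [integral_const_mul]
  have h2 : (c ^ (-p) * Ipol n p)⁻¹ ≤ (Znorm U p)⁻¹ := inv_anti₀ h.Z0 h.Zup
  calc (c / C) ^ p * (Ipol n p)⁻¹ * b = (c ^ (-p) * Ipol n p)⁻¹ * (C ^ (-p) * b) := by
        rw [Real.div_rpow hc.le hC.le, Real.rpow_neg hc.le, Real.rpow_neg hC.le, mul_inv, inv_inv]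
        ring
    _ ≤ _ := by
      refine mul_le_mul h2 ?_ (by positivity) (inv_nonneg.2 h.Z0.le)
      exact (mul_le_mul_of_nonneg_left hb hCp.le).trans h1

lemma Bds.upper {n : ℕ} {U : Euc n → ℝ} {p c C : ℝ} (h : Bds U p c C)
    (hZ : Integrable fun x : Euc n => (1 + U x / p) ^ (-p)) (S : Set (Euc n))
    (b : ℝ) (hb0 : 0 ≤ b) (hb : ∫ z in S, (1 + ‖z‖ ^ 2 / p) ^ (-p) ≤ b) :
    ∫ x in S, (Znorm U p)⁻¹ * (1 + U x / p) ^ (-p) ≤ (C / c) ^ p * (Ipol n p)⁻¹ * b := by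
  have hc := h.c0
  have hC := h.C0
  have h1 : ∫ x in S, (1 + U x / p) ^ (-p) ≤ c ^ (-p) * ∫ z in S, (1 + ‖z‖ ^ 2 / p) ^ (-p) := by
    rw [← integral_const_mul]
    exact integral_mono hZ.integrableOn (h.inth.const_mul _).integrableOn h.up
  have hCp : 0 < C ^ (-p) := Real.rpow_pos_of_pos hC _
  have hcp : 0 < c ^ (-p) := Real.rpow_pos_of_pos hc _
  have hI := h.I0
  have hZ0 := h.Z0
  rw [integral_const_mul]
  have h2 : (Znorm U p)⁻¹ ≤ (C ^ (-p) * Ipol n p)⁻¹ := inv_anti₀ (by positivity) h.Zlow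
  calc (Znorm U p)⁻¹ * ∫ x in S, (1 + U x / p) ^ (-p)
      ≤ (Znorm U p)⁻¹ * (c ^ (-p) * b) :=
        mul_le_mul_of_nonneg_left (h1.trans (mul_le_mul_of_nonneg_left hb hcp.le)) (by positivity)
    _ ≤ (C ^ (-p) * Ipol n p)⁻¹ * (c ^ (-p) * b) :=
        mul_le_mul_of_nonneg_right h2 (by positivity)
    _ = _ := by
        rw [Real.div_rpow hC.le hc.le, Real.rpow_neg hc.le, Real.rpow_neg hC.le, mul_inv, inv_inv]
        ring

/-- The final real-number algebra. -/
lemma final_algebra {n : ℕ} (hn : 1 ≤ n) (d D : ℝ) (hnd : (n : ℝ) ≤ d) (hdD : d ≤ D)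
    (c C c' C' I J ω R r : ℝ) (hc : 0 < c) (hC : 0 < C) (hc' : 0 < c') (hC' : 0 < C')
    (hI : 0 < I) (hJ : 0 < J) (hω : 0 < ω) (hR : 0 < R) (hRd : d ≤ R ^ 2) (hr : 0 < r)
    (h : (c / C) ^ d * I⁻¹ * ((125 * R ^ 2 / d) ^ (-d) * ((3 * R) ^ n * ω)) ≤
      (C' / c') ^ D * J⁻¹ * (D ^ D * ω * (r / 3) ^ (n - 2 * D))) :
    r ≤ 3 * ((C / c) ^ d * (C' / c') ^ D
        * (5 / 4) ^ d * 10 ^ (2 * d) * 3 ^ (-(n : ℝ)) * (D / d) ^ D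
        * (I / J)) ^ (1 / (2 * D - n)) * R := by
  have hn1 : (1 : ℝ) ≤ n := by exact_mod_cast hn
  have hd : 0 < d := by linarith
  have hD : 0 < D := by linarith
  have hq : 0 < 2 * D - n := by linarith
  set A := (C / c) ^ d * (C' / c') ^ D
        * (5 / 4) ^ d * 10 ^ (2 * d) * 3 ^ (-(n : ℝ)) * (D / d) ^ D
        * (I / J) with hA
  have hA0 : 0 < A := by positivity
  suffices hs : (r / (3 * R)) ^ (2 * D - n) ≤ A by
    have := Real.rpow_le_rpow (by positivity) hs (show 0 ≤ 1 / (2 * D - n) by positivity)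
    rw [← Real.rpow_mul (by positivity), mul_one_div_cancel hq.ne', Real.rpow_one,
      div_le_iff₀ (by positivity)] at this
    linarith
  have hrr : (r / 3) ^ ((n : ℝ) - 2 * D) = ((r / 3) ^ (2 * D - n))⁻¹ := by
    rw [← Real.rpow_neg (by positivity), neg_sub]
  have hsplit : (r / (3 * R)) ^ (2 * D - n) = (r / 3) ^ (2 * D - n) / R ^ (2 * D - n) := by
    rw [← Real.div_rpow (by positivity) hR.le, div_div]
  set X := (r / 3) ^ (2 * D - n) with hX
  have hX0 : 0 < X := by positivity
  rw [hsplit, div_le_iff₀ (by positivity)]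
  -- constants
  have e125 : (125 * R ^ 2 / d) ^ (-d) = ((5 / 4 : ℝ) ^ d * 10 ^ (2 * d))⁻¹ * (R ^ (2 * d))⁻¹ * d ^ d := by
    have e1 : (10 : ℝ) ^ (2 * d) = 100 ^ d := by
      rw [Real.rpow_mul (by norm_num)]; norm_num
    have e2 : R ^ (2 * d) = (R ^ 2) ^ d := by
      rw [Real.rpow_mul hR.le]; norm_num
    rw [e1, e2, ← Real.mul_rpow (by norm_num) (by norm_num), Real.rpow_neg (by positivity),
      Real.div_rpow (by positivity) hd.le, Real.mul_rpow (by norm_num) (by positivity)]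
    norm_num
    field_simp
  have e3 : (3 * R) ^ n = (3 ^ (-(n : ℝ)))⁻¹ * R ^ (n : ℝ) := by
    rw [Real.rpow_neg (by norm_num), inv_inv, Real.rpow_natCast, Real.rpow_natCast, mul_pow]
  have e4 : (c / C) ^ d = ((C / c) ^ d)⁻¹ := by
    rw [← Real.inv_rpow (by positivity), inv_div]
  have e5 : D ^ D = (D / d) ^ D * d ^ D := by
    rw [← Real.mul_rpow (by positivity) hd.le, div_mul_cancel₀ _ hd.ne']
  have e6 : d ^ D * (R ^ (2 * d)) ≤ d ^ d * (R ^ (2 * D - n) * R ^ (n : ℝ)) := by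
    have e7 : d ^ (D - d) ≤ (R ^ 2) ^ (D - d) := Real.rpow_le_rpow hd.le hRd (by linarith)
    have e8 : (R ^ 2) ^ (D - d) = R ^ (2 * (D - d)) := by
      rw [Real.rpow_mul hR.le]; norm_num
    rw [e8] at e7
    have e9 : d ^ D = d ^ d * d ^ (D - d) := by rw [← Real.rpow_add hd]; ring_nf
    have e10 : R ^ (2 * D - n) * R ^ (n : ℝ) = R ^ (2 * (D - d)) * R ^ (2 * d) := by
      rw [← Real.rpow_add hR, ← Real.rpow_add hR]; ring_nf
    rw [e9, e10, mul_assoc]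
    gcongr
  rw [e125, e3, e4, e5, hrr] at h
  rw [hA]
  clear_value X
  clear hA hsplit e125 e3 e4 e5 hrr hX hA0 A
  have p1 : 0 < (C / c) ^ d := by positivity
  have p2 : 0 < (C' / c') ^ D := by positivity
  have p3 : 0 < (5 / 4 : ℝ) ^ d := by positivity
  have p4 : 0 < (10 : ℝ) ^ (2 * d) := by positivity
  have p5 : 0 < (3 : ℝ) ^ (-(n : ℝ)) := by positivity
  have p6 : 0 < (D / d) ^ D := by positivity
  have p7 : 0 < R ^ (2 * d) := by positivity
  have p8 : 0 < R ^ (n : ℝ) := by positivity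
  have p9 : 0 < R ^ (2 * D - n) := by positivity
  have p10 : 0 < d ^ d := by positivity
  have p11 : 0 < d ^ D := by positivity
  generalize (C / c) ^ d = a1 at *
  generalize (C' / c') ^ D = a2 at *
  generalize (5 / 4 : ℝ) ^ d = a3 at *
  generalize (10 : ℝ) ^ (2 * d) = a4 at *
  generalize (3 : ℝ) ^ (-(n : ℝ)) = a5 at *
  generalize (D / d) ^ D = a6 at *
  generalize R ^ (2 * d) = a7 at *
  generalize R ^ (n : ℝ) = a8 at *
  generalize R ^ (2 * D - n) = a9 at *
  generalize d ^ d = a10 at *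
  generalize d ^ D = a11 at *
  -- multiply through
  have h' := mul_le_mul_of_nonneg_left h
    (show 0 ≤ a1 * I * a3 * a4 * a7 * a10⁻¹ * a5 * a8⁻¹ * ω⁻¹ * X by positivity)
  have l : a1 * I * a3 * a4 * a7 * a10⁻¹ * a5 * a8⁻¹ * ω⁻¹ * X *
      (a1⁻¹ * I⁻¹ * ((a3 * a4)⁻¹ * a7⁻¹ * a10 * (a5⁻¹ * a8 * ω))) = X := by
    field_simp
  have l2 : a1 * I * a3 * a4 * a7 * a10⁻¹ * a5 * a8⁻¹ * ω⁻¹ * X *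
      (a2 * J⁻¹ * (a6 * a11 * ω * X⁻¹)) =
      a1 * a2 * a3 * a4 * a5 * a6 * (I / J) * ((a11 * a7) / (a10 * a8)) := by
    field_simp
  rw [l, l2] at h'
  refine h'.trans ?_
  refine mul_le_mul_of_nonneg_left ?_ (by positivity)
  rw [div_le_iff₀ (by positivity)]
  linarith

/-- **Global linear growth estimate for the transport map.** -/
theorem global_linear_growth_estimate
    {n : ℕ} (hn : 1 ≤ n) (d D : ℝ) (hnd : (n : ℝ) ≤ d) (hdD : d ≤ D)
    (V W : Euc n → ℝ) (hVcont : Continuous V) (hWcont : Continuous W)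
    (hVlow : ∀ x, -d < V x) (hWlow : ∀ y, -D < W y)
    (hZV : Integrable fun x : Euc n => (1 + V x / d) ^ (-d))
    (hZW : Integrable fun y : Euc n => (1 + W y / D) ^ (-D))
    (hc0V : 0 < cLow V d univ) (hc0C0V : cLow V d univ ≤ cUp V d univ)
    (hC0V : BddAbove (range (ratio0 V d)))
    (hc0W : 0 < cLow W D univ) (hc0C0W : cLow W D univ ≤ cUp W D univ)
    (hC0W : BddAbove (range (ratio0 W D)))
    (φ : Euc n → ℝ) (hφconv : ConvexOn ℝ univ φ) (hφdiff : Differentiable ℝ φ)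
    (hpush : Measure.map (fun x => gradient φ x) (muUP V d) = muUP W D)
    (K M : ℝ)
    (hK : K = 3 * ((cUp V d univ / cLow V d univ) ^ d * (cUp W D univ / cLow W D univ) ^ D
        * (5 / 4) ^ d * 10 ^ (2 * d) * 3 ^ (-(n : ℝ)) * (D / d) ^ D
        * (Ipol n d / Ipol n D)) ^ (1 / (2 * D - n)))
    (hM : M = d / D * K ^ 2) :
    ∀ x : Euc n,
      ‖gradient φ x‖ ≤ K * max ‖x‖ (Real.sqrt d) ∧
        D + ‖gradient φ x‖ ^ 2 ≤ D / d * (1 + M) * (d + ‖x‖ ^ 2) := by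
  have hn1 : (1 : ℝ) ≤ n := by exact_mod_cast hn
  have hd : 0 < d := by linarith
  have hD : 0 < D := by linarith
  have bV := bds V d hd hVcont hVlow hZV hc0V hc0C0V hC0V
  have bW := bds W D hD hWcont hWlow hZW hc0W hc0C0W hC0W
  have hK0 : 0 ≤ K := by
    rw [hK]
    have := bV.I0
    have := bW.I0
    have := bV.C0
    have := bW.C0
    positivity
  have main : ∀ x : Euc n, ‖gradient φ x‖ ≤ K * max ‖x‖ (Real.sqrt d) := by
    intro x0
    set R := max ‖x0‖ (Real.sqrt d) with hRdef
    have hR : 0 < R := lt_max_of_lt_right (Real.sqrt_pos.2 hd)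
    have hRd : d ≤ R ^ 2 := by
      rw [← Real.sqrt_le_left hR.le]
      exact le_max_right _ _
    rcases (norm_nonneg (gradient φ x0)).eq_or_lt with h0 | hr
    · rw [← h0]; positivity
    obtain ⟨c, hc⟩ := growth_on_ball φ hφconv hφdiff x0 hr R hR (le_max_left _ _)
    set r := ‖gradient φ x0‖ with hrdef
    have hS : MeasurableSet {z : Euc n | r / 3 ≤ ‖z‖} :=
      measurableSet_le measurable_const measurable_norm
    have hω : 0 < unitBallVol n :=
      ENNReal.toReal_pos (measure_ball_pos volume _ one_pos).ne' measure_ball_lt_top.ne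
    have hmu : muUP V d (closedBall c (3 * R)) ≤ muUP W D {z : Euc n | r / 3 ≤ ‖z‖} := by
      rw [← hpush, Measure.map_apply (grad_meas φ) hS]
      exact measure_mono fun x hx => (hc x hx).2
    have t2 := bW.upper hZW _ (D ^ D * unitBallVol n * (r / 3) ^ (n - 2 * D)) (by positivity)
      (tail_bound hn D (by linarith) (r / 3) (by positivity) bW.inth)
    have t1 := bV.lower hZV _ _ (by positivity)
      (ball_bound d hd R hR hRd c (fun x hx => (hc x hx).1) bV.inth)
    rw [bV.meas _ measurableSet_closedBall, bW.meas _ hS, ENNReal.ofReal_le_ofReal_iff'] at hmu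
    have hmu' : ∫ x in closedBall c (3 * R), (Znorm V d)⁻¹ * (1 + V x / d) ^ (-d) ≤
        ∫ x in {z : Euc n | r / 3 ≤ ‖z‖}, (Znorm W D)⁻¹ * (1 + W x / D) ^ (-D) := by
      rcases hmu with h | h
      · exact h
      · refine h.trans (setIntegral_nonneg hS fun x _ => ?_)
        refine mul_nonneg (inv_nonneg.2 bW.Z0.le) ((mul_nonneg ?_ ?_).trans (bW.low x))
        · exact Real.rpow_nonneg bW.C0.le _
        · positivity
    rw [hK]
    exact final_algebra hn d D hnd hdD _ _ _ _ _ _ _ R r bV.c0 bV.C0 bW.c0 bW.C0 bV.I0 bW.I0 hω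
      hR hRd hr (t1.trans (hmu'.trans t2))
  intro x
  refine ⟨main x, ?_⟩
  have h1 := main x
  have h2 : (max ‖x‖ (Real.sqrt d)) ^ 2 ≤ d + ‖x‖ ^ 2 := by
    rcases max_choice ‖x‖ (Real.sqrt d) with h | h <;> rw [h]
    · linarith
    · rw [Real.sq_sqrt hd.le]; nlinarith [sq_nonneg ‖x‖]
  have h3 : ‖gradient φ x‖ ^ 2 ≤ K ^ 2 * (d + ‖x‖ ^ 2) := by
    calc _ ≤ (K * max ‖x‖ (Real.sqrt d)) ^ 2 := by gcongr
      _ = K ^ 2 * (max ‖x‖ (Real.sqrt d)) ^ 2 := by ring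
      _ ≤ _ := by gcongr
  have h4 : D / d * (1 + M) * (d + ‖x‖ ^ 2) =
      D + D / d * ‖x‖ ^ 2 + K ^ 2 * (d + ‖x‖ ^ 2) := by
    rw [hM]
    field_simp
  rw [h4]
  have : 0 ≤ D / d * ‖x‖ ^ 2 := by positivity
  linarith
end
end
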